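/- (Convergence of the worst-case window constellation) Let W ∈ ℕ^{L_2} and δ ∈ [0,1]. The worst-case window constellation q^{(l)}, defined from the initial constellation q^{(0)}_{(i,j)} = δ for i < 0 and q^{(0)}_{(i,j)} = 1 for i ≥ 0 by iterating the windowed update with window S^{W}_{(0,0)}, is entrywise nonincreasing in l: q^{(l+1)}_{(i,j)} ≤ q^{(l)}_{(i,j)} for all l ≥ 0 and all sections (i,j). Consequently, for every section (i,j) the sequence l ↦ q^{(l)}_{(i,j)} converges to a limit in [0,1]; in particular the limit lim_{l→∞} q^{(l)}_{(0,0)} exists. -/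

import Mathlib

/-- Check-node DE map `Y(z)` for the MD-SC ensemble. -/
noncomputable def chkY (L₂ dr γ₁ γ₂ : ℕ) (T : ℝ) (z : ℤ × ZMod L₂ → ℝ)
    (p : ℤ × ZMod L₂) : ℝ :=
  1 - (1 - ((1 - T) / (γ₁ : ℝ)) * ∑ k ∈ Finset.range γ₁, z (p.1 - (k : ℤ), p.2)
        - (T / ((γ₁ : ℝ) * ((γ₂ : ℝ) - 1))) *
            ∑ k ∈ Finset.range γ₁, ∑ r ∈ Finset.Icc 1 (γ₂ - 1),
              z (p.1 - (k : ℤ), p.2 - (r : ZMod L₂))) ^ (dr - 1)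

/-- One-step DE update `F(z)` for the MD-SC ensemble. -/
noncomputable def updF (L₂ dl dr γ₁ γ₂ : ℕ) (T ε : ℝ) (z : ℤ × ZMod L₂ → ℝ)
    (p : ℤ × ZMod L₂) : ℝ :=
  ε * (((1 - T) / (γ₁ : ℝ)) *
          ∑ k ∈ Finset.range γ₁, chkY L₂ dr γ₁ γ₂ T z (p.1 + (k : ℤ), p.2)
        + (T / ((γ₁ : ℝ) * ((γ₂ : ℝ) - 1))) *
            ∑ k ∈ Finset.range γ₁, ∑ r ∈ Finset.Icc 1 (γ₂ - 1),
              chkY L₂ dr γ₁ γ₂ T z (p.1 + (k : ℤ), p.2 + (r : ZMod L₂))) ^ (dl - 1)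
open Classical in
/-- The windowed DE update with window `S`. -/
noncomputable def winUpd (L₂ dl dr γ₁ γ₂ : ℕ) (T ε : ℝ) (S : Set (ℤ × ZMod L₂))
    (z : ℤ × ZMod L₂ → ℝ) (p : ℤ × ZMod L₂) : ℝ :=
  if p ∈ S then updF L₂ dl dr γ₁ γ₂ T ε z p else z p

/-- Iterates of the windowed DE update starting from `z₀`. -/
noncomputable def winIter (L₂ dl dr γ₁ γ₂ : ℕ) (T ε : ℝ) (S : Set (ℤ × ZMod L₂))
    (z₀ : ℤ × ZMod L₂ → ℝ) : ℕ → ℤ × ZMod L₂ → ℝ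
  | 0 => z₀
  | l + 1 => winUpd L₂ dl dr γ₁ γ₂ T ε S (winIter L₂ dl dr γ₁ γ₂ T ε S z₀ l)
/-- The window configuration `S^W_{(i_t,j_t)}` for window-size vector `W` and target
section `(i_t, j_t)`. -/
def winConfig (L₂ : ℕ) (W : ZMod L₂ → ℕ) (t : ℤ × ZMod L₂) : Set (ℤ × ZMod L₂) :=
  {p | ∃ r : ℕ, r < L₂ ∧ ∃ k : ℕ, k < W (t.2 + (r : ZMod L₂)) ∧
        p = (t.1 + (k : ℤ), t.2 + (r : ZMod L₂))}

/-- The worst-case initial constellation: `δ` for `i < 0` and `1` for `i ≥ 0`. -/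
noncomputable def worstInit (L₂ : ℕ) (δ : ℝ) : ℤ × ZMod L₂ → ℝ :=
  fun p => if p.1 < 0 then δ else 1

/-- The worst-case window constellation `q^[l]` for window-size vector `W`. -/
noncomputable def worstQ (L₂ dl dr γ₁ γ₂ : ℕ) (T ε δ : ℝ) (W : ZMod L₂ → ℕ) :
    ℕ → ℤ × ZMod L₂ → ℝ :=
  winIter L₂ dl dr γ₁ γ₂ T ε (winConfig L₂ W ((0 : ℤ), (0 : ZMod L₂))) (worstInit L₂ δ)

/-- The edge-spreading average with local weight `1 - T` and coupled weight `T`. -/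
noncomputable def coupledAvg (γ₁ γ₂ : ℕ) (T : ℝ) (a : ℕ → ℝ) (b : ℕ → ℕ → ℝ) : ℝ :=
  ((1 - T) / (γ₁ : ℝ)) * ∑ k ∈ Finset.range γ₁, a k
    + (T / ((γ₁ : ℝ) * ((γ₂ : ℝ) - 1))) *
        ∑ k ∈ Finset.range γ₁, ∑ r ∈ Finset.Icc 1 (γ₂ - 1), b k r

theorem coupledAvg_mono {γ₁ γ₂ : ℕ} {T : ℝ} (hγ₂ : 2 ≤ γ₂) (hT : T ∈ Set.Icc (0 : ℝ) 1)
    {a a' : ℕ → ℝ} {b b' : ℕ → ℕ → ℝ} (ha : ∀ k, a k ≤ a' k) (hb : ∀ k r, b k r ≤ b' k r) :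
    coupledAvg γ₁ γ₂ T a b ≤ coupledAvg γ₁ γ₂ T a' b' := by
  have h₁ : 0 ≤ (1 - T) / (γ₁ : ℝ) := div_nonneg (sub_nonneg.2 hT.2) (Nat.cast_nonneg _)
  have hγ : (2 : ℝ) ≤ γ₂ := by exact_mod_cast hγ₂
  have h₂ : 0 ≤ T / ((γ₁ : ℝ) * ((γ₂ : ℝ) - 1)) :=
    div_nonneg hT.1 (mul_nonneg (Nat.cast_nonneg _) (by linarith))
  unfold coupledAvg
  gcongr with k _ k _ r _
  · exact ha k
  · exact hb k r

theorem coupledAvg_const {γ₁ γ₂ : ℕ} (T c : ℝ) (hγ₁ : 1 ≤ γ₁) (hγ₂ : 2 ≤ γ₂) :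
    coupledAvg γ₁ γ₂ T (fun _ => c) (fun _ _ => c) = c := by
  have h₁ : (γ₁ : ℝ) ≠ 0 := by exact_mod_cast (by omega : γ₁ ≠ 0)
  have hγ : (2 : ℝ) ≤ γ₂ := by exact_mod_cast hγ₂
  have h₂ : (γ₂ : ℝ) - 1 ≠ 0 := by linarith
  have h₃ : ((γ₂ - 1 : ℕ) : ℝ) = (γ₂ : ℝ) - 1 := by
    rw [Nat.cast_sub (by omega), Nat.cast_one]
  simp only [coupledAvg, Finset.sum_const, Finset.card_range, Nat.card_Icc, nsmul_eq_mul,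
    Nat.add_sub_cancel, h₃]
  field_simp
  ring

theorem coupledAvg_mem_Icc {γ₁ γ₂ : ℕ} {T : ℝ} (hγ₁ : 1 ≤ γ₁) (hγ₂ : 2 ≤ γ₂)
    (hT : T ∈ Set.Icc (0 : ℝ) 1) {a : ℕ → ℝ} {b : ℕ → ℕ → ℝ}
    (ha : ∀ k, a k ∈ Set.Icc (0 : ℝ) 1) (hb : ∀ k r, b k r ∈ Set.Icc (0 : ℝ) 1) :
    coupledAvg γ₁ γ₂ T a b ∈ Set.Icc (0 : ℝ) 1 := by
  constructor
  · rw [← coupledAvg_const T 0 hγ₁ hγ₂]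
    exact coupledAvg_mono hγ₂ hT (fun k => (ha k).1) (fun k r => (hb k r).1)
  · rw [← coupledAvg_const T 1 hγ₁ hγ₂]
    exact coupledAvg_mono hγ₂ hT (fun k => (ha k).2) (fun k r => (hb k r).2)

theorem chkY_eq (L₂ dr γ₁ γ₂ : ℕ) (T : ℝ) (z : ℤ × ZMod L₂ → ℝ) (p : ℤ × ZMod L₂) :
    chkY L₂ dr γ₁ γ₂ T z p =
      1 - (1 - coupledAvg γ₁ γ₂ T (fun k => z (p.1 - (k : ℤ), p.2))
        (fun k r => z (p.1 - (k : ℤ), p.2 - (r : ZMod L₂)))) ^ (dr - 1) := by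
  rw [chkY, coupledAvg, sub_sub 1]

theorem updF_eq (L₂ dl dr γ₁ γ₂ : ℕ) (T ε : ℝ) (z : ℤ × ZMod L₂ → ℝ) (p : ℤ × ZMod L₂) :
    updF L₂ dl dr γ₁ γ₂ T ε z p =
      ε * coupledAvg γ₁ γ₂ T (fun k => chkY L₂ dr γ₁ γ₂ T z (p.1 + (k : ℤ), p.2))
        (fun k r => chkY L₂ dr γ₁ γ₂ T z (p.1 + (k : ℤ), p.2 + (r : ZMod L₂))) ^ (dl - 1) :=
  rfl

section Bounds

variable {L₂ dl dr γ₁ γ₂ : ℕ} {T ε : ℝ} {z z' : ℤ × ZMod L₂ → ℝ}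

theorem chkY_mem_Icc (hγ₁ : 1 ≤ γ₁) (hγ₂ : 2 ≤ γ₂) (hT : T ∈ Set.Icc (0 : ℝ) 1)
    (hz : ∀ p, z p ∈ Set.Icc (0 : ℝ) 1) (p : ℤ × ZMod L₂) :
    chkY L₂ dr γ₁ γ₂ T z p ∈ Set.Icc (0 : ℝ) 1 := by
  rw [chkY_eq]
  have h := coupledAvg_mem_Icc hγ₁ hγ₂ hT (fun k => hz (p.1 - (k : ℤ), p.2))
    (fun k r => hz (p.1 - (k : ℤ), p.2 - (r : ZMod L₂)))
  have h₀ := sub_nonneg.2 h.2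
  exact ⟨sub_nonneg.2 (pow_le_one₀ h₀ (sub_le_self _ h.1)), sub_le_self _ (pow_nonneg h₀ _)⟩

theorem chkY_mono (hγ₁ : 1 ≤ γ₁) (hγ₂ : 2 ≤ γ₂) (hT : T ∈ Set.Icc (0 : ℝ) 1)
    (hz' : ∀ p, z' p ∈ Set.Icc (0 : ℝ) 1) (h : ∀ p, z p ≤ z' p) (p : ℤ × ZMod L₂) :
    chkY L₂ dr γ₁ γ₂ T z p ≤ chkY L₂ dr γ₁ γ₂ T z' p := by
  rw [chkY_eq, chkY_eq]
  have h₀ := sub_nonneg.2 (coupledAvg_mem_Icc hγ₁ hγ₂ hT (fun k => hz' (p.1 - (k : ℤ), p.2))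
    (fun k r => hz' (p.1 - (k : ℤ), p.2 - (r : ZMod L₂)))).2
  exact sub_le_sub_left (pow_le_pow_left₀ h₀ (sub_le_sub_left
    (coupledAvg_mono hγ₂ hT (fun _ => h _) (fun _ _ => h _)) _) _) _

theorem updF_mem_Icc (hγ₁ : 1 ≤ γ₁) (hγ₂ : 2 ≤ γ₂) (hT : T ∈ Set.Icc (0 : ℝ) 1)
    (hε : ε ∈ Set.Icc (0 : ℝ) 1) (hz : ∀ p, z p ∈ Set.Icc (0 : ℝ) 1) (p : ℤ × ZMod L₂) :
    updF L₂ dl dr γ₁ γ₂ T ε z p ∈ Set.Icc (0 : ℝ) 1 := by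
  rw [updF_eq]
  have hY := chkY_mem_Icc (dr := dr) hγ₁ hγ₂ hT hz
  have h := coupledAvg_mem_Icc hγ₁ hγ₂ hT (fun k => hY (p.1 + (k : ℤ), p.2))
    (fun k r => hY (p.1 + (k : ℤ), p.2 + (r : ZMod L₂)))
  exact ⟨mul_nonneg hε.1 (pow_nonneg h.1 _),
    mul_le_one₀ hε.2 (pow_nonneg h.1 _) (pow_le_one₀ h.1 h.2)⟩

theorem updF_mono (hγ₁ : 1 ≤ γ₁) (hγ₂ : 2 ≤ γ₂) (hT : T ∈ Set.Icc (0 : ℝ) 1)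
    (hε : ε ∈ Set.Icc (0 : ℝ) 1) (hz : ∀ p, z p ∈ Set.Icc (0 : ℝ) 1)
    (hz' : ∀ p, z' p ∈ Set.Icc (0 : ℝ) 1) (h : ∀ p, z p ≤ z' p) (p : ℤ × ZMod L₂) :
    updF L₂ dl dr γ₁ γ₂ T ε z p ≤ updF L₂ dl dr γ₁ γ₂ T ε z' p := by
  rw [updF_eq, updF_eq]
  have hY := chkY_mem_Icc (dr := dr) hγ₁ hγ₂ hT hz
  have hYY := chkY_mono (dr := dr) hγ₁ hγ₂ hT hz' h
  have h₀ := (coupledAvg_mem_Icc hγ₁ hγ₂ hT (fun k => hY (p.1 + (k : ℤ), p.2))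
    (fun k r => hY (p.1 + (k : ℤ), p.2 + (r : ZMod L₂)))).1
  exact mul_le_mul_of_nonneg_left (pow_le_pow_left₀ h₀
    (coupledAvg_mono hγ₂ hT (fun _ => hYY _) (fun _ _ => hYY _)) _) hε.1

theorem winIter_mem_Icc (hγ₁ : 1 ≤ γ₁) (hγ₂ : 2 ≤ γ₂) (hT : T ∈ Set.Icc (0 : ℝ) 1)
    (hε : ε ∈ Set.Icc (0 : ℝ) 1) (S : Set (ℤ × ZMod L₂))
    (hz : ∀ p, z p ∈ Set.Icc (0 : ℝ) 1) (l : ℕ) (p : ℤ × ZMod L₂) :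
    winIter L₂ dl dr γ₁ γ₂ T ε S z l p ∈ Set.Icc (0 : ℝ) 1 := by
  induction l generalizing p with
  | zero => exact hz p
  | succ l ih =>
    rw [winIter, winUpd]
    split_ifs
    · exact updF_mem_Icc hγ₁ hγ₂ hT hε ih p
    · exact ih p

/-- If the initial constellation equals `1` on the window, the windowed iterates are entrywise
nonincreasing. -/
theorem winIter_succ_le (hγ₁ : 1 ≤ γ₁) (hγ₂ : 2 ≤ γ₂) (hT : T ∈ Set.Icc (0 : ℝ) 1)
    (hε : ε ∈ Set.Icc (0 : ℝ) 1) {S : Set (ℤ × ZMod L₂)}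
    (hz : ∀ p, z p ∈ Set.Icc (0 : ℝ) 1) (hS : ∀ p ∈ S, z p = 1) (l : ℕ) (p : ℤ × ZMod L₂) :
    winIter L₂ dl dr γ₁ γ₂ T ε S z (l + 1) p ≤ winIter L₂ dl dr γ₁ γ₂ T ε S z l p := by
  induction l generalizing p with
  | zero =>
    simp only [winIter, winUpd]
    split_ifs with hp
    · rw [hS p hp]
      exact (updF_mem_Icc hγ₁ hγ₂ hT hε hz p).2
    · exact le_rfl
  | succ l ih =>
    have hmem := winIter_mem_Icc (dl := dl) (dr := dr) hγ₁ hγ₂ hT hε S hz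
    rw [winIter]
    conv_rhs => rw [winIter]
    unfold winUpd
    split_ifs
    · exact updF_mono hγ₁ hγ₂ hT hε (hmem _) (hmem _) ih p
    · exact ih p

end Bounds

theorem worstInit_mem_Icc (L₂ : ℕ) {δ : ℝ} (hδ : δ ∈ Set.Icc (0 : ℝ) 1) (p : ℤ × ZMod L₂) :
    worstInit L₂ δ p ∈ Set.Icc (0 : ℝ) 1 := by
  unfold worstInit
  split_ifs
  · exact hδ
  · exact Set.right_mem_Icc.2 zero_le_one

theorem worstInit_eq_one_of_mem_winConfig {L₂ : ℕ} (δ : ℝ) {W : ZMod L₂ → ℕ}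
    {p : ℤ × ZMod L₂} (hp : p ∈ winConfig L₂ W (0, 0)) : worstInit L₂ δ p = 1 := by
  obtain ⟨r, -, k, -, rfl⟩ := hp
  exact if_neg (by simp)

/-- convergence of the worst-case window constellation: the
worst-case window constellation is entrywise nonincreasing in `l`, hence each
entry converges to a limit in `[0,1]`; in particular `lim_l q^[l]_{(0,0)}`
exists. -/
theorem stmt9 (dl dr L₂ γ₁ γ₂ : ℕ) (T ε δ : ℝ)
    (hdl : 2 ≤ dl) (hdr : 2 ≤ dr) (hL₂ : 2 ≤ L₂)
    (hγ₁ : 1 ≤ γ₁) (hγ₂ : 2 ≤ γ₂) (hγ₂L : γ₂ ≤ L₂)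
    (hT : T ∈ Set.Icc (0 : ℝ) 1) (hε : ε ∈ Set.Icc (0 : ℝ) 1)
    (hδ : δ ∈ Set.Icc (0 : ℝ) 1) (W : ZMod L₂ → ℕ) :
    (∀ (l : ℕ) (p : ℤ × ZMod L₂),
      worstQ L₂ dl dr γ₁ γ₂ T ε δ W (l + 1) p ≤ worstQ L₂ dl dr γ₁ γ₂ T ε δ W l p) ∧
    (∀ p : ℤ × ZMod L₂, ∃ a ∈ Set.Icc (0 : ℝ) 1,
      Filter.Tendsto (fun l => worstQ L₂ dl dr γ₁ γ₂ T ε δ W l p) Filter.atTop (nhds a)) ∧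
    (∃ a : ℝ, Filter.Tendsto
      (fun l => worstQ L₂ dl dr γ₁ γ₂ T ε δ W l ((0 : ℤ), (0 : ZMod L₂)))
      Filter.atTop (nhds a)) := by
  have hmem : ∀ (l : ℕ) (p : ℤ × ZMod L₂),
      worstQ L₂ dl dr γ₁ γ₂ T ε δ W l p ∈ Set.Icc (0 : ℝ) 1 :=
    winIter_mem_Icc hγ₁ hγ₂ hT hε _ (worstInit_mem_Icc L₂ hδ)
  have hanti : ∀ (l : ℕ) (p : ℤ × ZMod L₂),
      worstQ L₂ dl dr γ₁ γ₂ T ε δ W (l + 1) p ≤ worstQ L₂ dl dr γ₁ γ₂ T ε δ W l p :=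
    winIter_succ_le hγ₁ hγ₂ hT hε (worstInit_mem_Icc L₂ hδ)
      (fun _ hp => worstInit_eq_one_of_mem_winConfig δ hp)
  have hlim : ∀ p : ℤ × ZMod L₂, ∃ a ∈ Set.Icc (0 : ℝ) 1,
      Filter.Tendsto (fun l => worstQ L₂ dl dr γ₁ γ₂ T ε δ W l p) Filter.atTop (nhds a) := by
    intro p
    have ht := tendsto_atTop_ciInf (antitone_nat_of_succ_le fun l => hanti l p)
      ⟨0, Set.forall_mem_range.2 fun l => (hmem l p).1⟩
    exact ⟨_, isClosed_Icc.mem_of_tendsto ht (.of_forall fun l => hmem l p), ht⟩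
  obtain ⟨a, -, ha⟩ := hlim (0, 0)
  exact ⟨hanti, hlim, a, ha⟩
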